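/- Let Q be a full union of conjunctive queries with negation and inequalities (full UCQ¬,≠) with disjuncts Q₁,…,Q_m over schema σ, and let ρ = (U, rfacts_ρ) be a distribution policy over σ and network N. Then Q is not parallel-sound under ρ if and only if there exist an instance I of facts over σ with values from U with |I| ≤ max_{j∈{1,…,m}} |pos(Qⱼ)| + m, a node κ ∈ N, and a fact f such that f ∈ Q(dist_{ρ,I}(κ)) and f ∉ Q(I). -/

import Mathlib

/-- An atom `R(x₁,…,x_k)`: a relation name together with a tuple of variables. -/
structure Atom (R V : Type) where
  rel : R
  args : List V
deriving DecidableEq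

/-- A fact `R(t)`: a relation name together with a tuple of data values. -/
structure DBFact (R D : Type) where
  rel : R
  args : List D
deriving DecidableEq

/-- Applying a valuation to an atom yields a fact. -/
def Atom.app {R V D : Type} (f : V → D) (a : Atom R V) : DBFact R D :=
  ⟨a.rel, a.args.map f⟩

/-- The variables occurring in an atom. -/
def Atom.vars {R V : Type} (a : Atom R V) : Set V := {v | v ∈ a.args}

/-- A conjunctive query with negation and inequalities (CQ¬,≠): a head atom,
finite sets of positive and negated body atoms, and a finite set of
inequalities between variables. -/
structure CQ (R V : Type) where
  head : Atom R V
  pos : Finset (Atom R V)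
  neg : Finset (Atom R V)
  ineq : Finset (V × V)

namespace CQ

variable {R V D : Type}

/-- The variables occurring in a query. -/
def vars (Q : CQ R V) : Set V :=
  Q.head.vars ∪ (⋃ a ∈ (↑Q.pos : Set (Atom R V)), a.vars) ∪
    (⋃ a ∈ (↑Q.neg : Set (Atom R V)), a.vars) ∪
    (⋃ p ∈ (↑Q.ineq : Set (V × V)), {p.1, p.2})

/-- Safety: every head variable and every variable of a negated atom occurs in
some positive atom. -/
def safe (Q : CQ R V) : Prop :=
  (∀ v ∈ Q.head.vars, ∃ a ∈ Q.pos, v ∈ a.args) ∧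
  (∀ a ∈ Q.neg, ∀ v ∈ a.args, ∃ b ∈ Q.pos, v ∈ b.args)

/-- A query is full if every one of its variables occurs in its head atom. -/
def isFull (Q : CQ R V) : Prop := ∀ v ∈ Q.vars, v ∈ Q.head.args

/-- The facts required by a valuation `f`: `f(pos(Q))`. -/
def posFacts (Q : CQ R V) (f : V → D) : Set (DBFact R D) :=
  Atom.app f '' (↑Q.pos : Set (Atom R V))

/-- The facts prohibited by a valuation `f`: `f(neg(Q))`. -/
def negFacts (Q : CQ R V) (f : V → D) : Set (DBFact R D) :=
  Atom.app f '' (↑Q.neg : Set (Atom R V))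

/-- `f` is a valuation for `Q`: required and prohibited facts are disjoint and
all inequalities are respected. -/
def isVal (Q : CQ R V) (f : V → D) : Prop :=
  Q.posFacts f ∩ Q.negFacts f = ∅ ∧
  ∀ p ∈ Q.ineq, f p.1 ≠ f p.2

/-- `f` satisfies `Q` on `I`: all required facts are in `I` and no prohibited
fact is in `I`. -/
def sat (Q : CQ R V) (f : V → D) (I : Set (DBFact R D)) : Prop :=
  Q.posFacts f ⊆ I ∧ Q.negFacts f ∩ I = ∅

/-- `Q(I)`: the set of facts derived on `I` by valuations satisfying `Q`. -/
def eval (Q : CQ R V) (I : Set (DBFact R D)) : Set (DBFact R D) :=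
  {fc | ∃ f : V → D, Q.isVal f ∧ Q.sat f I ∧ Atom.app f Q.head = fc}

end CQ

/-- A union of conjunctive queries (with negation and inequalities): a finite,
nonempty family of CQ¬,≠s. -/
structure UCQ (R V : Type) where
  n : ℕ
  npos : 0 < n
  disj : Fin n → CQ R V

namespace UCQ

variable {R V D : Type}

/-- Well-formedness of a UCQ: every disjunct is safe, all disjuncts have the
same head relation, and distinct disjuncts have disjoint variable sets. -/
def wf (Q : UCQ R V) : Prop :=
  (∀ i, (Q.disj i).safe) ∧
  (∀ i j, (Q.disj i).head.rel = (Q.disj j).head.rel) ∧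
  (∀ i j, i ≠ j → Disjoint (Q.disj i).vars (Q.disj j).vars)

/-- `Q(I) = ⋃ᵢ Qᵢ(I)`. -/
def eval (Q : UCQ R V) (I : Set (DBFact R D)) : Set (DBFact R D) :=
  ⋃ i, (Q.disj i).eval I

/-- The maximum number of variables of any disjunct. -/
noncomputable def varmax (Q : UCQ R V) : ℕ :=
  Finset.univ.sup fun i => ((Q.disj i).vars).ncard

end UCQ

/-- The values of the fact all belong to `U`. -/
def DBFact.valsIn {R D : Type} (fc : DBFact R D) (U : Set D) : Prop :=
  ∀ d ∈ fc.args, d ∈ U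

/-- The active domain of an instance: all data values occurring in it. -/
def adom {R D : Type} (I : Set (DBFact R D)) : Set D :=
  {d | ∃ fc ∈ I, d ∈ fc.args}

/-- A distribution policy over network (node type) `K`: a universe `U` of data
values and, for each node, the set of facts (with values from `U`) it is
responsible for. -/
structure Policy (R D K : Type) where
  U : Set D
  rfacts : K → Set (DBFact R D)
  rfacts_vals : ∀ κ, ∀ fc ∈ rfacts κ, fc.valsIn U

namespace Policy
variable {R D K : Type}
/-- The local instance at node `κ`. -/
def dist (ρ : Policy R D K) (I : Set (DBFact R D)) (κ : K) : Set (DBFact R D) :=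
  I ∩ ρ.rfacts κ
end Policy

/-- `I` is an instance (finite set of facts) with values from `U`. -/
def instOver {R D : Type} (I : Set (DBFact R D)) (U : Set D) : Prop :=
  I.Finite ∧ ∀ fc ∈ I, fc.valsIn U

section Parallel
variable {R D K : Type}

/-- `q` is parallel-sound on `I` under `ρ`. -/
def parSoundOn (q : Set (DBFact R D) → Set (DBFact R D)) (ρ : Policy R D K)
    (I : Set (DBFact R D)) : Prop :=
  (⋃ κ : K, q (ρ.dist I κ)) ⊆ q I

/-- `q` is parallel-complete on `I` under `ρ`. -/
def parCompleteOn (q : Set (DBFact R D) → Set (DBFact R D)) (ρ : Policy R D K)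
    (I : Set (DBFact R D)) : Prop :=
  q I ⊆ ⋃ κ : K, q (ρ.dist I κ)

/-- `q` is parallel-correct on `I` under `ρ`. -/
def parCorrectOn (q : Set (DBFact R D) → Set (DBFact R D)) (ρ : Policy R D K)
    (I : Set (DBFact R D)) : Prop :=
  q I = ⋃ κ : K, q (ρ.dist I κ)

/-- `q` is parallel-sound under `ρ`: sound on every instance with values from
the universe of `ρ`. -/
def parSound (q : Set (DBFact R D) → Set (DBFact R D)) (ρ : Policy R D K) : Prop :=
  ∀ I : Set (DBFact R D), instOver I ρ.U → parSoundOn q ρ I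

/-- `q` is parallel-complete under `ρ`. -/
def parComplete (q : Set (DBFact R D) → Set (DBFact R D)) (ρ : Policy R D K) : Prop :=
  ∀ I : Set (DBFact R D), instOver I ρ.U → parCompleteOn q ρ I

/-- `q` is parallel-correct under `ρ`. -/
def parCorrect (q : Set (DBFact R D) → Set (DBFact R D)) (ρ : Policy R D K) : Prop :=
  ∀ I : Set (DBFact R D), instOver I ρ.U → parCorrectOn q ρ I

end Parallel

/-- Valuations of a full query are determined, on the prohibited facts, by the fact they derive. -/
theorem CQ.isFull.negFacts_eq {R V D : Type} {Q : CQ R V} (hfull : Q.isFull) {v w : V → D}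
    (h : Q.head.app v = Q.head.app w) : Q.negFacts v = Q.negFacts w := by
  have hvw : Q.head.args.map v = Q.head.args.map w := congrArg DBFact.args h
  refine Set.image_congr fun a ha => ?_
  refine congrArg (DBFact.mk a.rel) (List.map_congr_left fun x hx => ?_)
  refine List.map_inj_left.1 hvw x (hfull x (Or.inl (Or.inr ?_)))
  exact Set.mem_biUnion ha hx

/-- If a full query does not derive a fact on an instance, a single fact of that instance is enough
to block every valuation that could derive it. -/
theorem CQ.exists_subsingleton_inter_negFacts {R V D : Type} {Q : CQ R V} (hfull : Q.isFull)
    {I : Set (DBFact R D)} {fc : DBFact R D} (hfc : fc ∉ Q.eval I) :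
    ∃ s ⊆ I, s.Subsingleton ∧ ∀ v : V → D, Q.isVal v → Q.posFacts v ⊆ I →
      Q.head.app v = fc → (Q.negFacts v ∩ s).Nonempty := by
  by_cases h : ∃ v : V → D, Q.isVal v ∧ Q.posFacts v ⊆ I ∧ Q.head.app v = fc
  · obtain ⟨v, hv, hpos, hhead⟩ := h
    obtain ⟨g, hg, hgI⟩ : (Q.negFacts v ∩ I).Nonempty := by
      rw [Set.nonempty_iff_ne_empty]
      exact fun hneg => hfc ⟨v, hv, ⟨hpos, hneg⟩, hhead⟩
    refine ⟨{g}, Set.singleton_subset_iff.2 hgI, Set.subsingleton_singleton, ?_⟩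
    intro w _ _ hw
    exact ⟨g, hfull.negFacts_eq (hhead.trans hw.symm) ▸ hg, rfl⟩
  · exact ⟨∅, Set.empty_subset _, Set.subsingleton_empty,
      fun v hv hpos hhead => (h ⟨v, hv, hpos, hhead⟩).elim⟩

/-- A full UCQ¬,≠ `Q` with `m` disjuncts is not parallel-sound
under `ρ` iff there are an instance `I` over the universe of `ρ` with
`|I| ≤ maxⱼ |pos(Qⱼ)| + m`, a node `κ`, and a fact `f` with
`f ∈ Q(dist_{ρ,I}(κ))` and `f ∉ Q(I)`. -/
theorem full_ucq_not_parallel_sound_iff {R V D K : Type} [Infinite D] [Fintype K] [Nonempty K]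
    (Q : UCQ R V) (hQ : Q.wf) (hfull : ∀ i, (Q.disj i).isFull)
    (ρ : Policy R D K) :
    ¬ parSound (fun I => Q.eval I) ρ ↔
      ∃ I : Set (DBFact R D), instOver I ρ.U ∧
        I.ncard ≤ (Finset.univ.sup fun i => (Q.disj i).pos.card) + Q.n ∧
        ∃ κ : K, ∃ f : DBFact R D, f ∈ Q.eval (ρ.dist I κ) ∧ f ∉ Q.eval I := by
  constructor
  · intro h
    simp only [parSound, parSoundOn, not_forall, Set.not_subset, Set.mem_iUnion] at h
    obtain ⟨I, hI, fc, ⟨κ, hκ⟩, hfc⟩ := h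
    obtain ⟨j, v, hv, ⟨hpos, hneg⟩, hhead⟩ := Set.mem_iUnion.1 hκ
    choose s hsI hs hblock using fun i => CQ.exists_subsingleton_inter_negFacts (hfull i)
      fun hi => hfc (Set.mem_iUnion.2 ⟨i, hi⟩)
    have hsub : (Q.disj j).posFacts v ∪ ⋃ i, s i ⊆ I :=
      Set.union_subset (hpos.trans Set.inter_subset_left) (Set.iUnion_subset hsI)
    refine ⟨_, ⟨hI.1.subset hsub, fun g hg => hI.2 g (hsub hg)⟩, ?_, κ, fc, ?_, ?_⟩
    · refine (Set.ncard_union_le _ _).trans (add_le_add ?_ ?_)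
      · calc ((Q.disj j).posFacts v).ncard ≤ (Q.disj j).pos.card := by
              simpa [CQ.posFacts] using
                Set.ncard_image_le (f := Atom.app v) (Q.disj j).pos.finite_toSet
          _ ≤ _ := Finset.le_sup (f := fun i => (Q.disj i).pos.card) (Finset.mem_univ j)
      · calc (⋃ i, s i).ncard ≤ ∑ i, (s i).ncard := Set.ncard_iUnion_le_of_fintype s
          _ ≤ ∑ _i : Fin Q.n, 1 :=
              Finset.sum_le_sum fun i _ =>
                (Set.ncard_le_one (hs i).finite).2 fun _ ha _ hb => hs i ha hb
          _ = Q.n := by simp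
    · refine Set.mem_iUnion.2 ⟨j, v, hv, ⟨?_, ?_⟩, hhead⟩
      · exact fun g hg => ⟨Or.inl hg, (hpos hg).2⟩
      · exact Set.subset_eq_empty
          (Set.inter_subset_inter_right _ (Set.inter_subset_inter_left _ hsub)) hneg
    · intro h
      obtain ⟨i, w, hw, ⟨hwpos, hwneg⟩, hwhead⟩ := Set.mem_iUnion.1 h
      obtain ⟨g, hg, hgs⟩ := hblock i w hw (hwpos.trans hsub) hwhead
      exact (Set.eq_empty_iff_forall_notMem.1 hwneg g) ⟨hg, Or.inr (Set.mem_iUnion.2 ⟨i, hgs⟩)⟩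
  · rintro ⟨I, hI, -, κ, fc, hκ, hfc⟩ h
    exact hfc (h I hI (Set.mem_iUnion.2 ⟨κ, hκ⟩))
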